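/- Let A_0, A_1, ..., A_i be n×n row-stochastic real matrices. Then the coefficient of ergodicity is submultiplicative on their product: τ(A_i ··· A_1 A_0) ≤ τ(A_i) ··· τ(A_1) · τ(A_0). -/

import Mathlib

open Matrix

/-- A matrix is row-stochastic if all entries are nonnegative and every row
sums to `1`. -/
def RowStochastic {n : ℕ} (A : Matrix (Fin n) (Fin n) ℝ) : Prop :=
  (∀ i j, 0 ≤ A i j) ∧ ∀ i, ∑ j, A i j = 1

/-- The coefficient of ergodicity `τ(A) = 1 - min_{i,j} ∑_k min (A i k) (A j k)`. -/
noncomputable def tau {n : ℕ} (A : Matrix (Fin n) (Fin n) ℝ) : ℝ :=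
  1 - ⨅ p : Fin n × Fin n, ∑ k, min (A p.1 k) (A p.2 k)

theorem one_sub_tau_le {n : ℕ} (A : Matrix (Fin n) (Fin n) ℝ) (i j : Fin n) :
    1 - tau A ≤ ∑ k, min (A i k) (A j k) := by
  have h := ciInf_le (Finite.bddBelow_range
    fun p : Fin n × Fin n => ∑ k, min (A p.1 k) (A p.2 k)) (i, j)
  simpa [tau] using h

theorem tau_le_of_forall {n : ℕ} [NeZero n] (A : Matrix (Fin n) (Fin n) ℝ) (c : ℝ)
    (h : ∀ i j, 1 - c ≤ ∑ k, min (A i k) (A j k)) : tau A ≤ c := by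
  have : 1 - c ≤ ⨅ p : Fin n × Fin n, ∑ k, min (A p.1 k) (A p.2 k) :=
    le_ciInf fun p => h p.1 p.2
  unfold tau
  linarith

theorem tau_of_isEmpty (A : Matrix (Fin 0) (Fin 0) ℝ) : tau A = 1 := by
  simp [tau]

theorem RowStochastic.tau_nonneg {n : ℕ} {A : Matrix (Fin n) (Fin n) ℝ}
    (hA : RowStochastic A) : 0 ≤ tau A := by
  rcases n with _ | n
  · simp [tau_of_isEmpty]
  · have h := one_sub_tau_le A 0 0
    simp only [min_self, hA.2] at h
    linarith

theorem RowStochastic.mul {n : ℕ} {A B : Matrix (Fin n) (Fin n) ℝ}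
    (hA : RowStochastic A) (hB : RowStochastic B) : RowStochastic (A * B) := by
  refine ⟨fun i j => ?_, fun i => ?_⟩
  · rw [Matrix.mul_apply]
    exact Finset.sum_nonneg fun k _ => mul_nonneg (hA.1 i k) (hB.1 k j)
  simp only [Matrix.mul_apply]
  rw [Finset.sum_comm]
  simp [← Finset.mul_sum, hB.2, hA.2]

/-- Two nonnegative vectors of equal mass `d`, transported by a stochastic matrix `B`, overlap in
mass at least `d * (1 - τ(B))`. -/
theorem RowStochastic.mul_one_sub_tau_le {n : ℕ} {B : Matrix (Fin n) (Fin n) ℝ}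
    (hB : RowStochastic B) {u v : Fin n → ℝ} {d : ℝ} (hu : ∀ k, 0 ≤ u k) (hv : ∀ k, 0 ≤ v k)
    (hud : ∑ k, u k = d) (hvd : ∑ k, v k = d) :
    d * (1 - tau B) ≤ ∑ l, min (∑ k, u k * B k l) (∑ k, v k * B k l) := by
  have hd : 0 ≤ d := hud ▸ Finset.sum_nonneg fun k _ => hu k
  rcases hd.eq_or_lt with rfl | hd
  · rw [zero_mul]
    exact Finset.sum_nonneg fun l _ => le_min
      (Finset.sum_nonneg fun k _ => mul_nonneg (hu k) (hB.1 k l))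
      (Finset.sum_nonneg fun k _ => mul_nonneg (hv k) (hB.1 k l))
  refine le_of_mul_le_mul_left ?_ hd
  have hl : ∀ l, ∑ k, ∑ m, u k * v m * min (B k l) (B m l) ≤
      d * min (∑ k, u k * B k l) (∑ k, v k * B k l) := by
    intro l
    rw [mul_min_of_nonneg _ _ hd.le]
    refine le_min ?_ ?_
    · calc ∑ k, ∑ m, u k * v m * min (B k l) (B m l)
          ≤ ∑ k, ∑ m, u k * v m * B k l := by
            gcongr with k _ m _
            · exact mul_nonneg (hu k) (hv m)
            · exact min_le_left _ _
        _ = d * ∑ k, u k * B k l := by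
            rw [← hvd, Finset.sum_mul_sum, Finset.sum_comm]
            exact Finset.sum_congr rfl fun _ _ => Finset.sum_congr rfl fun _ _ => by ring
    · calc ∑ k, ∑ m, u k * v m * min (B k l) (B m l)
          ≤ ∑ k, ∑ m, u k * v m * B m l := by
            gcongr with k _ m _
            · exact mul_nonneg (hu k) (hv m)
            · exact min_le_right _ _
        _ = d * ∑ k, v k * B k l := by
            rw [← hud, Finset.sum_mul_sum]
            exact Finset.sum_congr rfl fun _ _ => Finset.sum_congr rfl fun _ _ => by ring
  calc d * (d * (1 - tau B))
      = ∑ k, ∑ m, u k * v m * (1 - tau B) := by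
        simp only [← Finset.sum_mul, ← Finset.mul_sum, hud, hvd]
        ring
    _ ≤ ∑ k, ∑ m, u k * v m * ∑ l, min (B k l) (B m l) := by
        gcongr with k _ m _
        · exact mul_nonneg (hu k) (hv m)
        · exact one_sub_tau_le B k m
    _ = ∑ l, ∑ k, ∑ m, u k * v m * min (B k l) (B m l) := by
        simp only [Finset.mul_sum]
        refine Eq.trans (Finset.sum_congr rfl fun k _ => ?_) Finset.sum_comm
        exact Finset.sum_comm
    _ ≤ ∑ l, d * min (∑ k, u k * B k l) (∑ k, v k * B k l) :=
        Finset.sum_le_sum fun l _ => hl l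
    _ = d * ∑ l, min (∑ k, u k * B k l) (∑ k, v k * B k l) := by rw [Finset.mul_sum]

theorem RowStochastic.tau_mul_le {n : ℕ} {A B : Matrix (Fin n) (Fin n) ℝ}
    (hA : RowStochastic A) (hB : RowStochastic B) : tau (A * B) ≤ tau A * tau B := by
  rcases n with _ | n
  · simp [tau_of_isEmpty]
  refine tau_le_of_forall _ _ fun i j => ?_
  set w : Fin (n + 1) → ℝ := fun k => min (A i k) (A j k) with hw
  have hsplit : ∀ r l, (A * B) r l = ∑ k, w k * B k l + ∑ k, (A r k - w k) * B k l := by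
    intro r l
    rw [Matrix.mul_apply, ← Finset.sum_add_distrib]
    exact Finset.sum_congr rfl fun _ _ => by ring
  have hmass : ∑ l, ∑ k, w k * B k l = ∑ k, w k := by
    rw [Finset.sum_comm]
    simp [← Finset.mul_sum, hB.2]
  have hkey := hB.mul_one_sub_tau_le (u := fun k => A i k - w k) (v := fun k => A j k - w k)
    (d := 1 - ∑ k, w k) (fun k => sub_nonneg.2 (min_le_left _ _))
    (fun k => sub_nonneg.2 (min_le_right _ _))
    (by rw [Finset.sum_sub_distrib, hA.2]) (by rw [Finset.sum_sub_distrib, hA.2])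
  simp only [hsplit, min_add_add_left, Finset.sum_add_distrib, hmass]
  have hle : 1 - ∑ k, w k ≤ tau A := by linarith [one_sub_tau_le A i j]
  linarith [mul_le_mul_of_nonneg_right hle hB.tau_nonneg]

theorem RowStochastic.prod_reverse_range {n : ℕ} {A : ℕ → Matrix (Fin n) (Fin n) ℝ} {i : ℕ}
    (hA : ∀ k ≤ i, RowStochastic (A k)) :
    RowStochastic ((List.range (i + 1)).reverse.map A).prod := by
  induction i with
  | zero => simpa using hA 0 le_rfl
  | succ i ih =>
    rw [List.range_succ, List.reverse_append]
    simpa using (hA (i + 1) le_rfl).mul (ih fun k hk => hA k (hk.trans i.le_succ))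

/-- The coefficient of ergodicity is submultiplicative on products of
row-stochastic matrices: `τ(A i ⋯ A 1 A 0) ≤ τ(A i) ⋯ τ(A 1) τ(A 0)`. -/
theorem statement10 {n : ℕ} (A : ℕ → Matrix (Fin n) (Fin n) ℝ) (i : ℕ)
    (hstoch : ∀ k ≤ i, RowStochastic (A k)) :
    tau (((List.range (i + 1)).reverse.map A).prod) ≤
      ∏ k ∈ Finset.range (i + 1), tau (A k) := by
  induction i with
  | zero => simp
  | succ i ih =>
    have hprev : ∀ k ≤ i, RowStochastic (A k) := fun k hk => hstoch k (hk.trans i.le_succ)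
    have hlast := hstoch (i + 1) le_rfl
    rw [List.range_succ, List.reverse_append, List.reverse_singleton, List.singleton_append,
      List.map_cons, List.prod_cons, Finset.prod_range_succ, mul_comm (∏ _ ∈ _, _)]
    exact (hlast.tau_mul_le (RowStochastic.prod_reverse_range hprev)).trans
      (mul_le_mul_of_nonneg_left (ih hprev) hlast.tau_nonneg)
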